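/- arXiv:1308.0531 — 2 statements merged into one kernel-verified Lean document; each statement's English description precedes it below -/
import Mathlib

section
/- Existence of a time periodic strictly positive solution from uniform persistence (nonlocal dispersal case; extraction of the proof of Theorem 2.1(3)). Assume f satisfies (H0). Suppose there exist constants M ≥ M₀, δ̄ > 0, T̄ ≥ 0 and a solution U of (E_f) on [0,∞) with U(0,x) = M for all x, such that U(t,x) ≥ δ̄ for all t ≥ T̄ and all x ∈ ℝ^N. Then (E_f) has a time periodic strictly positive solution u*; moreover sup_{x ∈ ℝ^N} |U(nT,x) − u*(0,x)| → 0 as n → ∞ (n ∈ ℕ). -/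
open MeasureTheory Set Filter RealInnerProductSpace

noncomputable section

abbrev Euc (N : ℕ) := EuclideanSpace ℝ (Fin N)

/-- Membership in `X`: bounded and uniformly continuous real functions on `ℝ^N`. -/
def MemX {N : ℕ} (u : Euc N → ℝ) : Prop :=
  UniformContinuous u ∧ ∃ C, ∀ x, |u x| ≤ C

/-- Hypotheses on the convolution kernel `κ`. -/
def KernelHyp {N : ℕ} (κ : Euc N → ℝ) : Prop :=
  Continuous κ ∧ (∀ z, 0 ≤ κ z) ∧ HasCompactSupport κ ∧ 0 < κ 0 ∧ (∫ z, κ z) = 1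

/-- Hypothesis (H0) on the nonlinearity `f`. -/
def SatH0 {N : ℕ} (T M₀ : ℝ) (f : ℝ → Euc N → ℝ → ℝ) : Prop :=
  (∀ t x u, f (t + T) x u = f t x u) ∧
  (∀ x : Euc N, ContDiff ℝ 1 (fun p : ℝ × ℝ => f p.1 x p.2)) ∧
  (∀ R : ℝ, 0 < R →
    (∃ C, ∀ t x u, |u| ≤ R →
      |f t x u| + |deriv (fun s => f s x u) t| + |deriv (fun v => f t x v) u| ≤ C) ∧
    UniformContinuousOn (fun p : ℝ × Euc N × ℝ => f p.1 p.2.1 p.2.2)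
      {p : ℝ × Euc N × ℝ | |p.2.2| ≤ R} ∧
    UniformContinuousOn (fun p : ℝ × Euc N × ℝ => deriv (fun s => f s p.2.1 p.2.2) p.1)
      {p : ℝ × Euc N × ℝ | |p.2.2| ≤ R} ∧
    UniformContinuousOn (fun p : ℝ × Euc N × ℝ => deriv (fun v => f p.1 p.2.1 v) p.2.2)
      {p : ℝ × Euc N × ℝ | |p.2.2| ≤ R}) ∧
  (∀ t x u, M₀ ≤ u → f t x u < 0) ∧
  (∀ a b : ℝ, 0 ≤ a → a ≤ b → ∃ c < (0:ℝ), ∀ t x u, a ≤ u → u ≤ b →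
    deriv (fun v => f t x v) u ≤ c)

/-- Right-hand side of the nonlocal dispersal KPP equation (E_g). -/
def RHS {N : ℕ} (κ : Euc N → ℝ) (g : ℝ → Euc N → ℝ → ℝ)
    (u : ℝ → Euc N → ℝ) (t : ℝ) (x : Euc N) : ℝ :=
  (∫ y, κ (y - x) * u t y) - u t x + u t x * g t x (u t x)

/-- A solution of (E_g) on the interval `I`. -/
def IsSol {N : ℕ} (κ : Euc N → ℝ) (g : ℝ → Euc N → ℝ → ℝ)
    (u : ℝ → Euc N → ℝ) (I : Set ℝ) : Prop :=
  ContinuousOn (fun p : ℝ × Euc N => u p.1 p.2) (I ×ˢ univ) ∧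
  (∀ t ∈ I, MemX (u t)) ∧
  (∀ J : Set ℝ, J ⊆ I → IsCompact J → ∃ C, ∀ t ∈ J, ∀ x, |u t x| ≤ C) ∧
  (∀ x : Euc N, ∀ t ∈ interior I, HasDerivAt (fun s => u s x) (RHS κ g u t x) t)

/-- A time periodic strictly positive solution of (E_g). -/
def PeriodicPosSol {N : ℕ} (κ : Euc N → ℝ) (g : ℝ → Euc N → ℝ → ℝ) (T : ℝ)
    (u : ℝ → Euc N → ℝ) : Prop :=
  IsSol κ g u univ ∧ (∀ t x, u (t + T) x = u t x) ∧ ∃ δ > 0, ∀ t x, δ ≤ u t x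

/-- The part metric between two strictly positive bounded functions. -/
def PartMetric {N : ℕ} (u v : Euc N → ℝ) : ℝ :=
  sInf (Real.log '' {α : ℝ | 1 ≤ α ∧ ∀ x, u x / α ≤ v x ∧ v x ≤ α * u x})

/-- Hypothesis (H1): `f` is asymptotically (in space) equal to the time and space
periodic nonlinearity `f₀`. -/
def SatH1 {N : ℕ} (T M₀ : ℝ) (p : Fin N → ℝ) (f f₀ : ℝ → Euc N → ℝ → ℝ) : Prop :=
  SatH0 T M₀ f₀ ∧ (∀ i, 0 < p i) ∧
  (∀ i t x u, f₀ t (x + p i • EuclideanSpace.single i (1:ℝ)) u = f₀ t x u) ∧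
  (∀ R : ℝ, 0 < R → ∀ ε : ℝ, 0 < ε → ∃ ρ : ℝ, ∀ t x u, ρ ≤ ‖x‖ → |u| ≤ R →
    |f t x u - f₀ t x u| ≤ ε)

/-- A time and space periodic positive solution of (E_g) (period `T` in time and
periods `pᵢ` in the spatial coordinate directions). -/
def PeriodicMediaSol {N : ℕ} (κ : Euc N → ℝ) (g : ℝ → Euc N → ℝ → ℝ) (T : ℝ)
    (p : Fin N → ℝ) (u : ℝ → Euc N → ℝ) : Prop :=
  IsSol κ g u univ ∧ (∀ t x, u (t + T) x = u t x) ∧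
  (∀ i t x, u t (x + p i • EuclideanSpace.single i (1:ℝ)) = u t x) ∧
  (∀ t x, 0 < u t x)

/-- The class `X⁺(ξ)` of front-like nonnegative initial data in the direction `ξ`. -/
def XplusXi {N : ℕ} (ξ : Euc N) (u : Euc N → ℝ) : Prop :=
  MemX u ∧ (∀ x, 0 ≤ u x) ∧
  (∃ m > 0, ∃ r : ℝ, ∀ x, ⟪x, ξ⟫ ≤ r → m ≤ u x) ∧
  (∃ r₀ : ℝ, ∀ x, r₀ ≤ ⟪x, ξ⟫ → u x = 0)


lemma scal_aux (y : ℝ → ℝ) (τ b : ℝ) (hc : ContinuousOn y (Icc 0 τ)) (h0 : b ≤ y 0)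
    (hd : ∀ t ∈ Ioo 0 τ, y t < b → ∃ d ≥ 0, HasDerivAt y d t) :
    ∀ t ∈ Icc 0 τ, b ≤ y t := by
  intro t1 ht1
  by_contra hlt
  push Not at hlt
  have hc1 : ContinuousOn y (Icc 0 t1) := hc.mono (Icc_subset_Icc_right ht1.2)
  have hS : IsCompact (Icc 0 t1 ∩ y ⁻¹' (Ici b)) :=
    isCompact_Icc.of_isClosed_subset
      (hc1.preimage_isClosed_of_isClosed isClosed_Icc isClosed_Ici) inter_subset_left
  obtain ⟨s, hs, hsmax⟩ := hS.exists_isGreatest ⟨0, ⟨le_refl 0, ht1.1⟩, h0⟩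
  have hsb : b ≤ y s := hs.2
  have hst : s < t1 := by
    rcases lt_or_eq_of_le hs.1.2 with h | h
    · exact h
    · subst h; linarith
  have hlt' : ∀ r ∈ Ioo s t1, ∃ d ≥ 0, HasDerivAt y d r := by
    intro r hr
    apply hd r ⟨lt_of_le_of_lt hs.1.1 hr.1, lt_of_lt_of_le hr.2 ht1.2⟩
    by_contra hh
    push Not at hh
    have := hsmax ⟨⟨hs.1.1.trans hr.1.le, hr.2.le⟩, hh⟩
    linarith [hr.1]
  have hm : MonotoneOn y (Icc s t1) := by
    apply monotoneOn_of_deriv_nonneg (convex_Icc s t1)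
      (hc1.mono (Icc_subset_Icc_left hs.1.1))
    · intro r hr
      rw [interior_Icc] at hr
      obtain ⟨d, _, h⟩ := hlt' r hr
      exact h.differentiableAt.differentiableWithinAt
    · intro r hr
      rw [interior_Icc] at hr
      obtain ⟨d, h1, h⟩ := hlt' r hr
      rw [h.deriv]; exact h1
  have := hm (left_mem_Icc.2 hst.le) (right_mem_Icc.2 hst.le) hst.le
  linarith

lemma K_int {N : ℕ} {κ : Euc N → ℝ} (hκ : KernelHyp κ) {u : Euc N → ℝ} (hu : Continuous u)
    (x : Euc N) : Integrable (fun y => κ (y - x) * u y) := by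
  have hk : Continuous (fun y => κ (y - x)) := hκ.1.comp (continuous_id.sub continuous_const)
  have hs : HasCompactSupport (fun y => κ (y - x)) :=
    hκ.2.2.1.comp_homeomorph (Homeomorph.subRight x)
  exact (hk.mul hu).integrable_of_hasCompactSupport hs.mul_right

lemma K_one {N : ℕ} {κ : Euc N → ℝ} (hκ : KernelHyp κ) (x : Euc N) :
    (∫ y, κ (y - x)) = 1 := by
  rw [integral_sub_right_eq_self κ x]; exact hκ.2.2.2.2

lemma K_le {N : ℕ} {κ : Euc N → ℝ} (hκ : KernelHyp κ) {u v : Euc N → ℝ} (hu : Continuous u)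
    (hv : Continuous v) (C : ℝ) (h : ∀ y, u y ≤ v y + C) (x : Euc N) :
    (∫ y, κ (y - x) * u y) ≤ (∫ y, κ (y - x) * v y) + C := by
  have h1 : (∫ y, κ (y - x) * C) = C := by rw [integral_mul_const, K_one hκ, one_mul]
  calc (∫ y, κ (y - x) * u y) ≤ ∫ y, (κ (y - x) * v y + κ (y - x) * C) := by
        apply integral_mono (K_int hκ hu x) ((K_int hκ hv x).add (K_int hκ continuous_const x))
        intro y
        have := mul_le_mul_of_nonneg_left (h y) (hκ.2.1 (y - x))
        simp only [Pi.add_apply]; linarith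
    _ = _ := by rw [integral_add (K_int hκ hv x) (K_int hκ continuous_const x), h1]

lemma comparison {N : ℕ} {κ : Euc N → ℝ} (hκ : KernelHyp κ) (z z' : ℝ → Euc N → ℝ)
    (τ L C : ℝ) (hzc : ∀ t ∈ Icc 0 τ, Continuous (z t))
    (hcont : ∀ x, ContinuousOn (fun t => z t x) (Icc 0 τ))
    (hC : ∀ t ∈ Icc 0 τ, ∀ x, -C ≤ z t x) (h0 : ∀ x, 0 ≤ z 0 x)
    (hd : ∀ t ∈ Ioo 0 τ, ∀ x, z t x < 0 → HasDerivAt (fun s => z s x) (z' t x) t ∧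
      (∫ y, κ (y - x) * z t y) + L * z t x ≤ z' t x) :
    ∀ t ∈ Icc 0 τ, ∀ x, 0 ≤ z t x := by
  have step : ∀ B : ℝ, 0 ≤ B → (∀ t ∈ Icc 0 τ, ∀ x, -B ≤ Real.exp (-(L + 2) * t) * z t x) →
      (∀ t ∈ Icc 0 τ, ∀ x, -(B / 2) ≤ Real.exp (-(L + 2) * t) * z t x) := by
    intro B hB hz t ht x
    apply scal_aux (fun t => Real.exp (-(L + 2) * t) * z t x) τ (-(B / 2)) _ _ _ t ht
    · exact (Continuous.continuousOn (by fun_prop)).mul (hcont x)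
    · have := h0 x
      simp only [mul_zero, Real.exp_zero, one_mul]; linarith
    · intro s hs hlt
      have hE : 0 < Real.exp (-(L + 2) * s) := Real.exp_pos _
      have hneg : z s x < 0 := by
        by_contra hh
        push Not at hh
        have := mul_nonneg hE.le hh
        linarith
      obtain ⟨h1, h2⟩ := hd s hs x hneg
      have hs' : s ∈ Icc 0 τ := ⟨hs.1.le, hs.2.le⟩
      have hE1 : HasDerivAt (fun s => Real.exp (-(L + 2) * s))
          (Real.exp (-(L + 2) * s) * (-(L + 2))) s := by
        have := ((hasDerivAt_id s).const_mul (-(L + 2))).exp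
        simpa using this
      refine ⟨_, ?_, hE1.mul h1⟩
      set E := Real.exp (-(L + 2) * s)
      have hK : (∫ y, κ (y - x) * (0:ℝ)) ≤ (∫ y, κ (y - x) * z s y) + B / E := by
        apply K_le hκ continuous_const (hzc s hs')
        intro y
        have := hz s hs' y
        have h3 : -B / E ≤ z s y := by rw [div_le_iff₀ hE]; linarith
        have h4 : -B / E = -(B / E) := neg_div _ _
        linarith
      simp only [mul_zero, integral_zero] at hK
      have h5 : E * (B / E) = B := by field_simp
      have h6 : E * ((∫ y, κ (y - x) * z s y) + L * z s x) ≤ E * z' s x :=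
        mul_le_mul_of_nonneg_left h2 hE.le
      have h7 := mul_le_mul_of_nonneg_left hK hE.le
      nlinarith
  intro t ht x
  set B := |C| * Real.exp (|L + 2| * τ) with hBdef
  have hB : 0 ≤ B := by positivity
  have hτ : 0 ≤ τ := ht.1.trans ht.2
  have hall : ∀ n : ℕ, ∀ t ∈ Icc 0 τ, ∀ x, -(B / 2 ^ n) ≤ Real.exp (-(L + 2) * t) * z t x := by
    intro n
    induction n with
    | zero =>
      intro t ht x
      have h1 : Real.exp (-(L + 2) * t) ≤ Real.exp (|L + 2| * τ) := by
        apply Real.exp_le_exp.2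
        have := neg_abs_le (L + 2)
        nlinarith [abs_nonneg (L + 2), ht.1, ht.2]
      have h2 : - |C| ≤ z t x := by linarith [hC t ht x, le_abs_self C]
      have hE : 0 < Real.exp (-(L + 2) * t) := Real.exp_pos _
      have h3 := mul_le_mul_of_nonneg_left h2 hE.le
      have h4 := mul_le_mul_of_nonneg_left h1 (abs_nonneg C)
      simp only [pow_zero, div_one]
      nlinarith
    | succ n ih =>
      intro t ht x
      have := step (B / 2 ^ n) (by positivity) ih t ht x
      rwa [div_div, ← pow_succ] at this
  have hlim : Tendsto (fun n : ℕ => -(B / 2 ^ n)) atTop (nhds 0) := by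
    have : Tendsto (fun n : ℕ => -(B * (1 / 2 : ℝ) ^ n)) atTop (nhds (-(B * 0))) :=
      ((tendsto_pow_atTop_nhds_zero_of_lt_one (by norm_num) (by norm_num)).const_mul B).neg
    simpa [div_eq_mul_inv] using this
  have h' : 0 ≤ Real.exp (-(L + 2) * t) * z t x :=
    le_of_tendsto' hlim (fun n => hall n t ht x)
  exact nonneg_of_mul_nonneg_right h' (Real.exp_pos _)

lemma f_period {N : ℕ} {T M₀ : ℝ} {f : ℝ → Euc N → ℝ → ℝ} (hf : SatH0 T M₀ f) (n : ℕ) (t : ℝ)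
    (x : Euc N) (u : ℝ) : f (t + n * T) x u = f t x u := by
  induction n with
  | zero => simp
  | succ n ih =>
    rw [← ih, ← hf.1 (t + n * T) x u]
    congr 1; push_cast; ring

lemma f_facts {N : ℕ} {T M₀ : ℝ} {f : ℝ → Euc N → ℝ → ℝ} (hf : SatH0 T M₀ f) (M : ℝ)
    (hM : 0 < M) : ∃ c > 0, ∃ C > 0,
      (∀ t x a b, 0 ≤ a → a ≤ b → b ≤ M → f t x b ≤ f t x a - c * (b - a)) ∧
      (∀ t x u, |u| ≤ M → |f t x u| ≤ C) ∧
      (∀ t x a b, a ∈ Icc 0 M → b ∈ Icc 0 M → |f t x a - f t x b| ≤ C * |a - b|) := by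
  obtain ⟨_, hdiff, hR, _, hmono⟩ := hf
  obtain ⟨c, hc, hc'⟩ := hmono 0 M le_rfl hM.le
  obtain ⟨⟨C, hC⟩, _⟩ := hR M hM
  have hd : ∀ t x, Differentiable ℝ (fun v => f t x v) := by
    intro t x
    have h1 := (hdiff x).differentiable (by norm_num)
    exact h1.comp (f := fun v : ℝ => (t, v)) (by fun_prop)
  refine ⟨-c, by linarith, |C| + 1, by positivity, ?_, ?_, ?_⟩
  · intro t x a b ha hab hb
    have := (convex_Icc (0:ℝ) M).image_sub_le_mul_sub_of_deriv_le (f := fun v => f t x v) (C := c)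
      (hd t x).continuous.continuousOn (hd t x).differentiableOn
      (fun v hv => by
        rw [interior_Icc] at hv
        exact hc' t x v hv.1.le hv.2.le) a ⟨ha, hab.trans hb⟩ b ⟨ha.trans hab, hb⟩ hab
    linarith
  · intro t x u hu
    have := hC t x u hu
    linarith [abs_nonneg (deriv (fun s => f s x u) t), abs_nonneg (deriv (fun v => f t x v) u),
      le_abs_self C]
  · intro t x a b ha hb
    have := (convex_Icc (0:ℝ) M).norm_image_sub_le_of_norm_deriv_le (f := fun v => f t x v)
      (C := |C| + 1) (fun v _ => (hd t x) v) (fun v hv => by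
        have := hC t x v (abs_le.2 ⟨by linarith [hv.1], hv.2⟩)
        rw [Real.norm_eq_abs]
        linarith [abs_nonneg (deriv (fun s => f s x v) t), abs_nonneg (f t x v),
          le_abs_self C]) hb ha
    simpa [Real.norm_eq_abs] using this

lemma U_cont_t {N : ℕ} {κ : Euc N → ℝ} {f : ℝ → Euc N → ℝ → ℝ} {U : ℝ → Euc N → ℝ}
    (hU : IsSol κ f U (Set.Ici 0)) (x : Euc N) : ContinuousOn (fun t => U t x) (Ici 0) :=
  hU.1.comp (f := fun t : ℝ => (t, x)) (Continuous.continuousOn (by fun_prop))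
    (fun t ht => ⟨ht, mem_univ _⟩)

lemma U_le {N : ℕ} {T M₀ : ℝ} (hM₀ : 0 < M₀)
    {κ : Euc N → ℝ} (hκ : KernelHyp κ)
    {f : ℝ → Euc N → ℝ → ℝ} (hf : SatH0 T M₀ f)
    {M : ℝ} (hMM₀ : M₀ ≤ M)
    {U : ℝ → Euc N → ℝ} (hU : IsSol κ f U (Set.Ici 0)) (hU0 : ∀ x, U 0 x = M) :
    ∀ t ≥ 0, ∀ x, U t x ≤ M := by
  intro τ hτ x
  obtain ⟨C, hC⟩ := hU.2.2.1 (Icc 0 τ) (fun t ht => ht.1) isCompact_Icc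
  have := comparison hκ (fun t x => M - U t x) (fun t x => - RHS κ f U t x) τ 0 (C - M)
    (fun t ht => continuous_const.sub (hU.2.1 t ht.1).1.continuous)
    (fun x => continuousOn_const.sub ((U_cont_t hU x).mono (fun t ht => ht.1)))
    (fun t ht x => by have := (abs_le.1 (hC t ht x)).2; linarith)
    (fun x => by rw [hU0 x]; simp)
    (fun t ht x hz => by
      have hder := hU.2.2.2 x t (by rw [interior_Ici]; exact ht.1)
      refine ⟨hder.const_sub M, ?_⟩
      have hcu := (hU.2.1 t ht.1.le).1.continuous
      have hKz : (∫ y, κ (y - x) * (M - U t y)) = M - ∫ y, κ (y - x) * U t y := by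
        simp_rw [mul_sub]
        rw [integral_sub (K_int hκ continuous_const x) (K_int hκ hcu x), integral_mul_const,
          K_one hκ, one_mul]
      have hneg := hf.2.2.2.1 t x (U t x) (by linarith)
      have : U t x * f t x (U t x) ≤ 0 :=
        mul_nonpos_of_nonneg_of_nonpos (by linarith) hneg.le
      simp only [RHS, hKz]
      linarith) τ ⟨hτ, le_rfl⟩ x
  linarith

lemma decay {N : ℕ} {T M₀ : ℝ} (hT : 0 < T)
    {κ : Euc N → ℝ} (hκ : KernelHyp κ)
    {f : ℝ → Euc N → ℝ → ℝ} (hf : SatH0 T M₀ f)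
    {M δ S c C : ℝ} (hM : 0 < M) (hδ : 0 < δ) (hS : 0 ≤ S) (hc : 0 < c)
    (hfc : ∀ t x a b, 0 ≤ a → a ≤ b → b ≤ M → f t x b ≤ f t x a - c * (b - a))
    (hfC : ∀ t x u, |u| ≤ M → |f t x u| ≤ C)
    {U : ℝ → Euc N → ℝ} (hU : IsSol κ f U (Set.Ici 0)) (hUM : ∀ t ≥ 0, ∀ x, U t x ≤ M)
    (hpers : ∀ t ≥ S, ∀ x, δ ≤ U t x) (j k : ℕ) (τ : ℝ) (hτ : 0 ≤ τ) (x : Euc N) :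
    U (S + τ + j * T) x - U (S + τ + k * T) x ≤ M / δ * M * Real.exp (-(c * δ) * τ) := by
  have hA : 0 ≤ M / δ := by positivity
  have hpos : ∀ (n : ℕ) (t : ℝ), 0 ≤ t → S ≤ S + t + n * T := fun n t ht => by
    have : 0 ≤ (n:ℝ) * T := by positivity
    linarith
  have hder : ∀ (n : ℕ) (t : ℝ) (x : Euc N), 0 < t →
      HasDerivAt (fun s => U (S + s + n * T) x) ((∫ y, κ (y - x) * U (S + t + n * T) y)
        - U (S + t + n * T) x + U (S + t + n * T) x * f (S + t) x (U (S + t + n * T) x)) t := by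
    intro n t x ht
    have h1 := hU.2.2.2 x (S + t + n * T) (by
      rw [interior_Ici, mem_Ioi]
      have : 0 ≤ (n:ℝ) * T := by positivity
      linarith)
    have h2 : HasDerivAt (fun s : ℝ => S + s + n * T) 1 t :=
      ((hasDerivAt_id t).const_add S).add_const _
    have h3 := HasDerivAt.comp (h₂ := fun r => U r x) t h1 h2
    rw [mul_one] at h3
    simp only [RHS, f_period hf] at h3
    exact h3
  have hcx : ∀ (n : ℕ) (t : ℝ), 0 ≤ t → Continuous (U (S + t + n * T)) := fun n t ht =>
    (hU.2.1 _ (hS.trans (hpos n t ht))).1.continuous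
  have hct : ∀ (n : ℕ) (x : Euc N), ContinuousOn (fun t => U (S + t + n * T) x) (Icc 0 τ) :=
    fun n x => (U_cont_t hU x).comp (f := fun t : ℝ => S + t + n * T)
      (Continuous.continuousOn (by fun_prop)) (fun t ht => hS.trans (hpos n t ht.1))
  have hE1 : ∀ t, HasDerivAt (fun s => 1 + M / δ * Real.exp (-(c * δ) * s))
          (M / δ * (Real.exp (-(c * δ) * t) * (-(c * δ)))) t := by
    intro t
    have := ((((hasDerivAt_id t).const_mul (-(c * δ))).exp).const_mul (M / δ)).const_add 1
    simpa using this
  have key := comparison hκ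
    (fun t x => (1 + M / δ * Real.exp (-(c * δ) * t)) * U (S + t + k * T) x - U (S + t + j * T) x)
    (fun t x => ((M / δ * (Real.exp (-(c * δ) * t) * (-(c * δ)))) * U (S + t + k * T) x
      + (1 + M / δ * Real.exp (-(c * δ) * t)) * ((∫ y, κ (y - x) * U (S + t + k * T) y)
        - U (S + t + k * T) x + U (S + t + k * T) x * f (S + t) x (U (S + t + k * T) x)))
        - ((∫ y, κ (y - x) * U (S + t + j * T) y)
        - U (S + t + j * T) x + U (S + t + j * T) x * f (S + t) x (U (S + t + j * T) x)))
    τ C M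
    (fun t ht => (continuous_const.mul (hcx k t ht.1)).sub (hcx j t ht.1))
    (fun x => ((Continuous.continuousOn (by fun_prop)).mul (hct k x)).sub (hct j x))
    (fun t ht x => by
      have h1 := hUM _ (hS.trans (hpos j t ht.1)) x
      have h2 := hpers _ (hpos k t ht.1) x
      have : 0 ≤ (1 + M / δ * Real.exp (-(c * δ) * t)) * U (S + t + k * T) x :=
        mul_nonneg (by positivity) (by linarith)
      linarith)
    (fun x => by
      have h1 := hUM _ (hS.trans (hpos j 0 le_rfl)) x
      have h2 := hpers _ (hpos k 0 le_rfl) x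
      simp only [mul_zero, Real.exp_zero, mul_one]
      have h3 : M / δ * δ ≤ M / δ * U (S + 0 + k * T) x := mul_le_mul_of_nonneg_left h2 hA
      have h4 : M / δ * δ = M := by field_simp
      linarith)
    (fun t ht x hz => by
      refine ⟨((hE1 t).mul (hder k t x ht.1)).sub (hder j t x ht.1), ?_⟩
      have hjM := hUM _ (hS.trans (hpos j t ht.1.le)) x
      have hkδ := hpers _ (hpos k t ht.1.le) x
      have hKz : (∫ y, κ (y - x) * ((1 + M / δ * Real.exp (-(c * δ) * t)) * U (S + t + k * T) y
          - U (S + t + j * T) y)) = (1 + M / δ * Real.exp (-(c * δ) * t)) *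
          (∫ y, κ (y - x) * U (S + t + k * T) y) - ∫ y, κ (y - x) * U (S + t + j * T) y := by
        rw [← integral_const_mul, ← integral_sub ((K_int hκ (hcx k t ht.1.le) x).const_mul _)
          (K_int hκ (hcx j t ht.1.le) x)]
        congr 1; ext y; ring
      rw [hKz]
      have he : 0 ≤ M / δ * Real.exp (-(c * δ) * t) := by positivity
      rw [show M / δ * (Real.exp (-(c * δ) * t) * (-(c * δ))) =
        (M / δ * Real.exp (-(c * δ) * t)) * (-(c * δ)) by ring]
      generalize M / δ * Real.exp (-(c * δ) * t) = e at *
      generalize (∫ y, κ (y - x) * U (S + t + k * T) y) = Kw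
      generalize (∫ y, κ (y - x) * U (S + t + j * T) y) = Kv
      generalize U (S + t + k * T) x = w at *
      generalize U (S + t + j * T) x = v at *
      have hw : 0 < w := by linarith
      have hWw : w ≤ (1 + e) * w := by nlinarith
      have f1 := hfc (S + t) x w ((1 + e) * w) hw.le hWw (by linarith)
      have f2 := hfc (S + t) x ((1 + e) * w) v (by linarith) (by linarith) hjM
      have f3 := (abs_le.1 (hfC (S + t) x ((1 + e) * w)
        (abs_le.2 ⟨by linarith, by linarith⟩))).2
      generalize hWdef : (1 + e) * w = W at *
      generalize f (S + t) x w = fw at *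
      generalize f (S + t) x v = fv at *
      generalize f (S + t) x W = fW at *
      have hv : 0 < v := by linarith
      have g1 : W * (fW + c * (W - w)) ≤ W * fw :=
        mul_le_mul_of_nonneg_left (by linarith) (by linarith)
      have g2 : v * fv ≤ v * fW := mul_le_mul_of_nonneg_left
        (by nlinarith) hv.le
      have g3 : C * (W - v) ≤ fW * (W - v) := mul_le_mul_of_nonpos_right f3 hz.le
      have hWe : W - w = e * w := by rw [← hWdef]; ring
      have g4 : e * (c * δ) * w ≤ W * (c * (W - w)) := by
        rw [hWe]
        have : e * c * w * δ ≤ e * c * w * W :=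
          mul_le_mul_of_nonneg_left (by linarith) (by positivity)
        linarith
      have e1 : (1 + e) * (Kw - w + w * fw) = (1 + e) * Kw - W + W * fw := by
        rw [← hWdef]; ring
      rw [e1]
      linarith)
    τ ⟨hτ, le_rfl⟩ x
  have h1 := hUM _ (hS.trans (hpos k τ hτ)) x
  have h2 : M / δ * Real.exp (-(c * δ) * τ) * U (S + τ + k * T) x
      ≤ M / δ * Real.exp (-(c * δ) * τ) * M :=
    mul_le_mul_of_nonneg_left h1 (by positivity)
  linarith

/-- existence of a time periodic strictly positive solution from
uniform persistence. -/
theorem stmt13 {N : ℕ} (hN : 1 ≤ N) (T M₀ : ℝ) (hT : 0 < T) (hM₀ : 0 < M₀)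
    (κ : Euc N → ℝ) (hκ : KernelHyp κ)
    (f : ℝ → Euc N → ℝ → ℝ) (hf : SatH0 T M₀ f)
    (M δbar Tbar : ℝ) (hMM₀ : M₀ ≤ M) (hδbar : 0 < δbar) (hTbar : 0 ≤ Tbar)
    (U : ℝ → Euc N → ℝ) (hU : IsSol κ f U (Set.Ici 0)) (hU0 : ∀ x, U 0 x = M)
    (hpers : ∀ t ≥ Tbar, ∀ x, δbar ≤ U t x) :
    ∃ ustar : ℝ → Euc N → ℝ, PeriodicPosSol κ f T ustar ∧
      ∀ ε > (0:ℝ), ∃ n₀ : ℕ, ∀ n ≥ n₀, ∀ x, |U ((n : ℝ) * T) x - ustar 0 x| ≤ ε := by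
  have hM : 0 < M := hM₀.trans_le hMM₀
  have hUM := U_le hM₀ hκ hf hMM₀ hU hU0
  obtain ⟨c, hc, C, hC, hfc, hfC, hfL⟩ := f_facts hf M hM
  obtain ⟨B, hBdef⟩ : ∃ B, B = M / δbar * M := ⟨_, rfl⟩
  obtain ⟨μ, hμdef⟩ : ∃ μ, μ = c * δbar := ⟨_, rfl⟩
  have hB : 0 < B := by rw [hBdef]; positivity
  have hμ : 0 < μ := by rw [hμdef]; positivity
  have hdec : ∀ s ≥ Tbar, ∀ (k : ℕ) (x : Euc N),
      |U (s + k * T) x - U s x| ≤ B * Real.exp (-μ * (s - Tbar)) := by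
    intro s hs k x
    have h1 := decay hT hκ hf hM hδbar hTbar hc hfc hfC hU hUM hpers k 0 (s - Tbar)
      (by linarith) x
    have h2 := decay hT hκ hf hM hδbar hTbar hc hfc hfC hU hUM hpers 0 k (s - Tbar)
      (by linarith) x
    simp only [Nat.cast_zero, zero_mul, add_zero, add_sub_cancel, ← hBdef, ← hμdef] at h1 h2
    exact abs_le.2 ⟨by linarith, h1⟩
  have hexp : ∀ a : ℝ, Tendsto (fun n : ℕ => B * Real.exp (-μ * (a + n * T - Tbar))) atTop
      (nhds 0) := by
    intro a
    have h1 : Tendsto (fun n : ℕ => (n : ℝ) * (μ * T) + μ * (a - Tbar)) atTop atTop :=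
      tendsto_atTop_add_const_right _ _
        (tendsto_natCast_atTop_atTop.atTop_mul_const (by positivity))
    have h2 := (Real.tendsto_exp_neg_atTop_nhds_zero.comp h1).const_mul B
    rw [mul_zero] at h2
    refine h2.congr (fun n => ?_)
    simp only [Function.comp]
    congr 2; ring
  have hunif : ∀ a : ℝ, ∀ ε > 0, ∃ n₀ : ℕ, ∀ n ≥ n₀, ∀ t ≥ a, Tbar ≤ t + n * T ∧ 0 < t + n * T ∧
      B * Real.exp (-μ * (t + n * T - Tbar)) < ε := by
    intro a ε hε
    have h1 : Tendsto (fun n : ℕ => (n : ℝ) * T + a) atTop atTop :=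
      tendsto_atTop_add_const_right _ _ (tendsto_natCast_atTop_atTop.atTop_mul_const hT)
    obtain ⟨n₀, h⟩ := eventually_atTop.1 (((h1.eventually_ge_atTop Tbar).and
      (h1.eventually_gt_atTop 0)).and ((hexp a).eventually (gt_mem_nhds hε)))
    refine ⟨n₀, fun n hn t ht => ?_⟩
    obtain ⟨⟨h2, h3⟩, h4⟩ := h n hn
    refine ⟨by linarith, by linarith, lt_of_le_of_lt ?_ h4⟩
    apply mul_le_mul_of_nonneg_left _ hB.le
    apply Real.exp_le_exp.2
    nlinarith
  have hlim : ∀ t x, ∃ l, Tendsto (fun n : ℕ => U (t + n * T) x) atTop (nhds l) := by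
    intro t x
    obtain ⟨n₀, hn₀⟩ := hunif t 1 one_pos
    have hs := (hn₀ n₀ le_rfl t le_rfl).1
    have hcs : CauchySeq (fun n : ℕ => U (t + n₀ * T + n * T) x) := by
      refine cauchySeq_of_le_tendsto_0'
        (fun n : ℕ => B * Real.exp (-μ * (t + n₀ * T + n * T - Tbar))) ?_ (hexp _)
      intro n m hnm
      obtain ⟨k, rfl⟩ := Nat.exists_eq_add_of_le hnm
      have := hdec (t + n₀ * T + n * T)
        (by have : 0 ≤ (n:ℝ) * T := by positivity
            linarith) k x
      rw [dist_comm, Real.dist_eq]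
      convert this using 4
      push_cast; ring
    obtain ⟨l, hl⟩ := cauchySeq_tendsto_of_complete hcs
    refine ⟨l, (tendsto_add_atTop_iff_nat n₀).1 (hl.congr fun n => ?_)⟩
    congr 1; push_cast; ring
  choose us hus using hlim
  have hbd : ∀ t x (n : ℕ), Tbar ≤ t + n * T →
      |us t x - U (t + n * T) x| ≤ B * Real.exp (-μ * (t + n * T - Tbar)) := by
    intro t x n hn
    have h1 : Tendsto (fun k : ℕ => |U (t + n * T + k * T) x - U (t + n * T) x|) atTop
        (nhds |us t x - U (t + n * T) x|) := by
      refine (Tendsto.sub_const ?_ _).abs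
      refine ((tendsto_add_atTop_iff_nat n).2 (hus t x)).congr fun k => ?_
      congr 1; push_cast; ring
    exact le_of_tendsto' h1 (fun k => hdec _ hn k x)
  have hunif2 : ∀ a : ℝ, ∀ ε > 0, ∃ n₀ : ℕ, ∀ n ≥ n₀, ∀ t ≥ a, Tbar ≤ t + n * T ∧
      0 < t + n * T ∧ ∀ x, |us t x - U (t + n * T) x| < ε := by
    intro a ε hε
    obtain ⟨n₀, h⟩ := hunif a ε hε
    refine ⟨n₀, fun n hn t ht => ?_⟩
    obtain ⟨h1, h2, h3⟩ := h n hn t ht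
    exact ⟨h1, h2, fun x => lt_of_le_of_lt (hbd t x n h1) h3⟩
  have hev : ∀ t x, ∀ᶠ n : ℕ in atTop, U (t + n * T) x ∈ Icc δbar M := by
    intro t x
    obtain ⟨n₀, h⟩ := hunif t 1 one_pos
    filter_upwards [eventually_ge_atTop n₀] with n hn
    obtain ⟨h1, h2, _⟩ := h n hn t le_rfl
    exact ⟨hpers _ h1 x, hUM _ h2.le x⟩
  have hmem : ∀ t x, us t x ∈ Icc δbar M := fun t x =>
    isClosed_Icc.mem_of_tendsto (hus t x) (hev t x)
  have hper : ∀ t x, us (t + T) x = us t x := by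
    intro t x
    refine tendsto_nhds_unique (hus (t + T) x) ?_
    refine ((tendsto_add_atTop_iff_nat 1).2 (hus t x)).congr fun k => ?_
    congr 1; push_cast; ring
  have hcont : Continuous (fun p : ℝ × Euc N => us p.1 p.2) := by
    rw [continuous_iff_continuousAt]
    rintro ⟨t₀, x₀⟩
    have hco : ContinuousOn (fun p : ℝ × Euc N => us p.1 p.2) (Ioi (t₀ - 1) ×ˢ univ) := by
      apply continuousOn_of_uniform_approx_of_continuousOn
      intro u hu
      obtain ⟨ε, hε, hεu⟩ := Metric.mem_uniformity_dist.1 hu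
      obtain ⟨n₀, h⟩ := hunif2 (t₀ - 1) ε hε
      refine ⟨fun p => U (p.1 + n₀ * T) p.2, ?_, ?_⟩
      · exact hU.1.comp (f := fun p : ℝ × Euc N => (p.1 + n₀ * T, p.2))
          (Continuous.continuousOn (by fun_prop))
          (fun p hp => ⟨(h n₀ le_rfl p.1 (le_of_lt hp.1)).2.1.le, mem_univ _⟩)
      · intro p hp
        apply hεu
        rw [Real.dist_eq]
        exact (h n₀ le_rfl p.1 (le_of_lt hp.1)).2.2 p.2
    exact hco.continuousAt ((isOpen_Ioi.prod isOpen_univ).mem_nhds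
      ⟨by simp, mem_univ _⟩)
  have hX : ∀ t, MemX (us t) := by
    intro t
    refine ⟨?_, M, fun x => abs_le.2 ⟨by linarith [(hmem t x).1], (hmem t x).2⟩⟩
    rw [Metric.uniformContinuous_iff]
    intro ε hε
    obtain ⟨n₀, h⟩ := hunif2 t (ε / 3) (by positivity)
    obtain ⟨_, h2, h3⟩ := h n₀ le_rfl t le_rfl
    obtain ⟨d, hd, hd'⟩ := Metric.uniformContinuous_iff.1 (hU.2.1 (t + n₀ * T) h2.le).1
      (ε / 3) (by positivity)
    refine ⟨d, hd, fun {a b} hab => ?_⟩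
    have e1 := abs_lt.1 (h3 a)
    have e2 := abs_lt.1 (h3 b)
    have e3 := hd' hab
    rw [Real.dist_eq] at e3 ⊢
    have e3 := abs_lt.1 e3
    exact abs_lt.2 ⟨by linarith, by linarith⟩
  have hderiv : ∀ x t, HasDerivAt (fun s => us s x) (RHS κ f us t x) t := by
    intro x t₀
    refine hasDerivAt_of_tendstoUniformlyOn (l := atTop) (s := Ioi (t₀ - 1)) isOpen_Ioi
      (f := fun (n : ℕ) s => U (s + n * T) x) (f' := fun (n : ℕ) s => RHS κ f U (s + n * T) x)
      (g' := fun s => RHS κ f us s x) ?_ ?_ (fun s _ => hus s x) (by simp)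
    · rw [Metric.tendstoUniformlyOn_iff]
      intro ε hε
      have hQ : 0 < 3 + C + M * C := by positivity
      obtain ⟨n₀, h⟩ := hunif2 (t₀ - 1) (ε / (3 + C + M * C)) (by positivity)
      filter_upwards [eventually_ge_atTop n₀] with n hn t ht
      obtain ⟨h1, h2, h3⟩ := h n hn t (le_of_lt ht)
      generalize hη : ε / (3 + C + M * C) = η at h3
      have hηε : (3 + C + M * C) * η = ε := by rw [← hη]; field_simp
      have hη0 : 0 < η := by rw [← hη]; positivity
      have cu := (hX t).1.continuous
      have cU := (hU.2.1 (t + n * T) h2.le).1.continuous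
      have k1 := K_le hκ cu cU η (fun y => by have := (abs_lt.1 (h3 y)).2; linarith) x
      have k2 := K_le hκ cU cu η (fun y => by have := (abs_lt.1 (h3 y)).1; linarith) x
      have hv := hmem t x
      have hw : U (t + n * T) x ∈ Icc δbar M := ⟨hpers _ h1 x, hUM _ h2.le x⟩
      have h3x := h3 x
      rw [Real.dist_eq]
      simp only [RHS, f_period hf]
      generalize (∫ y, κ (y - x) * us t y) = Ku at *
      generalize (∫ y, κ (y - x) * U (t + n * T) y) = KU at *
      generalize us t x = v at *
      generalize U (t + n * T) x = w at *
      have l1 := hfL t x v w ⟨by linarith [hv.1], hv.2⟩ ⟨by linarith [hw.1], hw.2⟩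
      have l2 := hfC t x v (abs_le.2 ⟨by linarith [hv.1], hv.2⟩)
      generalize f t x v = fv at *
      generalize f t x w = fw at *
      have m1 : |v * fv - w * fw| ≤ C * η + M * (C * η) := by
        rw [show v * fv - w * fw = fv * (v - w) + w * (fv - fw) by ring]
        refine (abs_add_le _ _).trans (add_le_add ?_ ?_)
        · rw [abs_mul]
          exact mul_le_mul l2 h3x.le (abs_nonneg _) hC.le
        · rw [abs_mul]
          refine mul_le_mul (abs_le.2 ⟨by linarith [hw.1], hw.2⟩) ?_ (abs_nonneg _) hM.le
          exact l1.trans (mul_le_mul_of_nonneg_left h3x.le hC.le)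
      have m2 := abs_le.1 m1
      have m3 := abs_lt.1 h3x
      exact abs_lt.2 ⟨by nlinarith, by nlinarith⟩
    · obtain ⟨n₀, h⟩ := hunif2 (t₀ - 1) 1 one_pos
      filter_upwards [eventually_ge_atTop n₀] with n hn t ht
      have h2 := (h n hn t (le_of_lt ht)).2.1
      have h1 := hU.2.2.2 x (t + n * T) (by rw [interior_Ici]; exact h2)
      exact h1.comp_add_const t (n * T)
  refine ⟨us, ⟨⟨hcont.continuousOn, fun t _ => hX t, fun J _ _ => ⟨M, fun t _ x =>
    abs_le.2 ⟨by linarith [(hmem t x).1], (hmem t x).2⟩⟩, fun x t _ => hderiv x t⟩, hper,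
    δbar, hδbar, fun t x => (hmem t x).1⟩, ?_⟩
  intro ε hε
  obtain ⟨n₀, h⟩ := hunif2 0 ε hε
  refine ⟨n₀, fun n hn x => ?_⟩
  have := (h n hn 0 le_rfl).2.2 x
  rw [zero_add] at this
  rw [abs_sub_comm]
  exact this.le

end
end

section
/- Persistence at sublinear spreading speed implies locally uniform convergence to the periodic solution, radial version (Lemma 5.1(3), nonlocal dispersal case). Assume f satisfies (H0), (H1) holds with limit nonlinearity f₀, (E_f) has a time periodic strictly positive solution u*, and (E_{f₀}) has a solution u₀* on ℝ with u₀*(t+T,x) = u₀*(t,x) = u₀*(t, x+pᵢeᵢ) for all t, x, i and u₀*(t,x) > 0 everywhere. Let c > 0 and let u be a solution of (E_f) on [0,∞) with u(0,x) ≥ 0 for all x. If there exist δ > 0 and T* > 0 such that u(t,x) ≥ δ whenever t ≥ T* and ‖x‖ ≤ ct, then for every 0 < c' < c, sup{ |u(t,x) − u*(t,x)| : ‖x‖ ≤ c't } → 0 as t → ∞. -/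
open MeasureTheory Set Filter RealInnerProductSpace

noncomputable section

/-- One-dimensional barrier step. -/
theorem aux_barrier (g g' B B' : ℝ → ℝ) (a b : ℝ)
    (hc : ContinuousOn g (Icc a b)) (hd : ∀ t ∈ Ioo a b, HasDerivAt g (g' t) t)
    (ha : g a < B a) (hB : ∀ t, HasDerivAt B (B' t) t)
    (hbound : ∀ t ∈ Ioo a b, g t = B t → g' t < B' t) :
    ∀ t ∈ Icc a b, g t ≤ B t := by
  intro t ht
  rcases eq_or_lt_of_le ht.1 with h | hat
  · rw [← h]; exact ha.le
  have hBc : Continuous B := continuous_iff_continuousAt.2 fun s => (hB s).continuousAt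
  have h1 : Tendsto (fun s => B s - g s) (nhdsWithin a (Icc a b)) (nhds (B a - g a)) :=
    (hBc.continuousAt.continuousWithinAt).sub (hc a (left_mem_Icc.2 (ht.1.trans ht.2)))
  have h2 : ∀ᶠ s in nhdsWithin a (Icc a b), 0 < B s - g s :=
    h1.eventually (lt_mem_nhds (by linarith))
  have h3 : ∀ᶠ s in nhdsWithin a (Ioo a t), 0 < B s - g s :=
    h2.filter_mono (nhdsWithin_mono _ (show Ioo a t ⊆ Icc a b from fun s hs => ⟨hs.1.le, hs.2.le.trans ht.2⟩))
  have hne : (nhdsWithin a (Ioo a t)).NeBot := by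
    rw [nhdsWithin_Ioo_eq_nhdsGT hat]; infer_instance
  obtain ⟨s, hs, hs'⟩ := (h3.and self_mem_nhdsWithin).exists
  refine image_le_of_deriv_right_lt_deriv_boundary (f := g) (f' := g') (a := s) (b := t)
    (hc.mono (Icc_subset_Icc hs'.1.le ht.2)) ?_ (by linarith) hB ?_ ⟨hs'.2.le, le_rfl⟩
  · intro r hr
    exact (hd r ⟨hs'.1.trans_le hr.1, hr.2.trans_le ht.2⟩).hasDerivWithinAt
  · intro r hr
    exact hbound r ⟨hs'.1.trans_le hr.1, hr.2.trans_le ht.2⟩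

/-- Maximum principle. -/
theorem aux_mp {α : Type*} (w dw : ℝ → α → ℝ) (a b K C : ℝ) (hK : 0 < K)
    (hcont : ∀ x, ContinuousOn (fun s => w s x) (Icc a b))
    (hder : ∀ x, ∀ t ∈ Ioo a b, HasDerivAt (fun s => w s x) (dw t x) t)
    (hbd : ∀ t ∈ Icc a b, ∀ x, w t x ≤ C)
    (h0 : ∀ x, w a x ≤ 0)
    (hineq : ∀ t ∈ Ioo a b, ∀ x, 0 < w t x → ∀ S, 0 ≤ S → (∀ y, w t y ≤ S) → dw t x ≤ K * S) :
    ∀ t ∈ Icc a b, ∀ x, w t x ≤ 0 := by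
  have step : ∀ S : ℝ, 0 < S →
      (∀ t ∈ Icc a b, ∀ x, w t x ≤ S * Real.exp (2 * K * (t - a))) →
      ∀ t ∈ Icc a b, ∀ x, w t x ≤ (3 / 4 * S) * Real.exp (2 * K * (t - a)) := by
    intro S hS hw t ht x
    refine aux_barrier (fun s => w s x) (fun s => dw s x)
      (fun s => (3 / 4 * S) * Real.exp (2 * K * (s - a)))
      (fun s => (3 / 4 * S) * (Real.exp (2 * K * (s - a)) * (2 * K * 1))) a b
      (hcont x) (hder x) ?_ ?_ ?_ t ht
    · have := h0 x
      simp only [sub_self, mul_zero, Real.exp_zero, mul_one]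
      linarith
    · intro s
      exact ((((hasDerivAt_id s).sub_const a).const_mul (2 * K)).exp).const_mul _
    · intro s hs he
      try simp only at he ⊢
      have hE := Real.exp_pos (2 * K * (s - a))
      have hp : 0 < w s x := by rw [he]; positivity
      have := hineq s hs x hp (S * Real.exp (2 * K * (s - a))) (by positivity)
        (hw s ⟨hs.1.le, hs.2.le⟩)
      have : 0 < K * S * Real.exp (2 * K * (s - a)) := by positivity
      nlinarith
  have all : ∀ n : ℕ, ∀ t ∈ Icc a b, ∀ x,
      w t x ≤ ((3 / 4 : ℝ) ^ n * (|C| + 1)) * Real.exp (2 * K * (t - a)) := by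
    intro n
    induction n with
    | zero =>
      intro t ht x
      have h1 : 1 ≤ Real.exp (2 * K * (t - a)) := by
        apply Real.one_le_exp
        have := ht.1
        have : 0 ≤ t - a := by linarith
        positivity
      have h2 := hbd t ht x
      have h3 := le_abs_self C
      have h4 := abs_nonneg C
      simp only [pow_zero, one_mul]
      nlinarith
    | succ n ih =>
      have := step ((3 / 4 : ℝ) ^ n * (|C| + 1)) (by positivity) ih
      intro t ht x
      have h := this t ht x
      rw [pow_succ]
      linarith
  intro t ht x
  have hl : Tendsto (fun n : ℕ => ((3 / 4 : ℝ) ^ n * (|C| + 1)) * Real.exp (2 * K * (t - a)))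
      atTop (nhds ((0 * (|C| + 1)) * Real.exp (2 * K * (t - a)))) :=
    ((tendsto_pow_atTop_nhds_zero_of_lt_one (by norm_num) (by norm_num)).mul_const _).mul_const _
  have := ge_of_tendsto' hl (fun n => all n t ht x)
  simpa using this

theorem aux_J_int {N : ℕ} {κ : Euc N → ℝ} (hκ : KernelHyp κ) {v : Euc N → ℝ} (hv : Continuous v)
    (x : Euc N) : Integrable (fun y => κ (y - x) * v y) := by
  apply Continuous.integrable_of_hasCompactSupport
  · exact (hκ.1.comp (continuous_id.sub continuous_const)).mul hv
  · have : HasCompactSupport (fun y => κ (y - x)) :=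
      hκ.2.2.1.comp_homeomorph (Homeomorph.subRight x)
    exact this.mul_right

theorem aux_J_le {N : ℕ} {κ : Euc N → ℝ} (hκ : KernelHyp κ) {R : ℝ}
    (hR : ∀ z, κ z ≠ 0 → ‖z‖ ≤ R) {v : Euc N → ℝ} (hv : Continuous v)
    (x : Euc N) (S : ℝ) (h : ∀ y, ‖y - x‖ ≤ R → v y ≤ S) : (∫ y, κ (y - x) * v y) ≤ S := by
  have h1 : (∫ y, κ (y - x) * v y) ≤ ∫ y, κ (y - x) * S := by
    apply integral_mono (aux_J_int hκ hv x) (aux_J_int hκ continuous_const x)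
    intro y
    by_cases hy : κ (y - x) = 0
    · simp [hy]
    · exact mul_le_mul_of_nonneg_left (h y (hR _ hy)) (hκ.2.1 _)
  rw [integral_mul_const, integral_sub_right_eq_self κ x, hκ.2.2.2.2, one_mul] at h1
  exact h1

theorem aux_J_comb {N : ℕ} {κ : Euc N → ℝ} (hκ : KernelHyp κ) {v w : Euc N → ℝ}
    (hv : Continuous v) (hw : Continuous w) (a b : ℝ) (x : Euc N) :
    (∫ y, κ (y - x) * (a * v y + b * w y)) =
      a * (∫ y, κ (y - x) * v y) + b * ∫ y, κ (y - x) * w y := by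
  rw [← integral_const_mul, ← integral_const_mul, ← integral_add
    ((aux_J_int hκ hv x).const_mul a) ((aux_J_int hκ hw x).const_mul b)]
  congr 1; ext y; ring

theorem aux_R {N : ℕ} {κ : Euc N → ℝ} (hκ : KernelHyp κ) :
    ∃ R, 0 < R ∧ ∀ z, κ z ≠ 0 → ‖z‖ ≤ R := by
  obtain ⟨R, hR0, hR⟩ := hκ.2.2.1.isCompact.isBounded.exists_pos_norm_le
  exact ⟨R, hR0, fun z hz => hR z (subset_tsupport _ hz)⟩

theorem aux_mono {N : ℕ} {T M₀ : ℝ} {f : ℝ → Euc N → ℝ → ℝ} (hf : SatH0 T M₀ f) (b : ℝ)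
    (hb : 0 ≤ b) : ∃ η > 0, ∀ t x r s, 0 ≤ r → r ≤ s → s ≤ b →
      f t x s - f t x r ≤ -η * (s - r) := by
  obtain ⟨c, hc, h⟩ := hf.2.2.2.2 0 b le_rfl hb
  refine ⟨-c, by linarith, ?_⟩
  intro t x r s hr hrs hs
  have hd : Differentiable ℝ (fun v => f t x v) := by
    have h1 : Differentiable ℝ (fun p : ℝ × ℝ => f p.1 x p.2) :=
      (hf.2.1 x).differentiable (by norm_num)
    exact h1.comp ((differentiable_const t).prodMk differentiable_id)
  rw [neg_neg]
  refine (convex_Icc (0:ℝ) b).image_sub_le_mul_sub_of_deriv_le hd.continuous.continuousOn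
    hd.differentiableOn ?_ r ⟨hr, hrs.trans hs⟩ s ⟨hr.trans hrs, hs⟩ hrs
  intro v hv
  have := interior_subset hv
  exact h t x v this.1 this.2

theorem aux_fbd {N : ℕ} {T M₀ : ℝ} {f : ℝ → Euc N → ℝ → ℝ} (hf : SatH0 T M₀ f) (R : ℝ) :
    ∃ C > 0, ∀ t x u, |u| ≤ R → |f t x u| ≤ C := by
  obtain ⟨C, hC⟩ := (hf.2.2.1 (|R| + 1) (by positivity)).1
  refine ⟨|C| + 1, by positivity, ?_⟩
  intro t x u hu
  have := hC t x u (by linarith [le_abs_self R])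
  have := le_abs_self C
  have := abs_nonneg (deriv (fun s => f s x u) t)
  have := abs_nonneg (deriv (fun v => f t x v) u)
  linarith

theorem aux_cont {N : ℕ} {κ : Euc N → ℝ} {g : ℝ → Euc N → ℝ → ℝ}
    {u : ℝ → Euc N → ℝ} {I : Set ℝ} (hu : IsSol κ g u I) (x : Euc N) :
    ContinuousOn (fun s => u s x) I := by
  have := hu.1
  exact this.comp (f := fun s : ℝ => (s, x)) (by fun_prop) (fun s hs => ⟨hs, mem_univ _⟩)

theorem aux_nonneg {N : ℕ} {T M₀ : ℝ} {κ : Euc N → ℝ} (hκ : KernelHyp κ)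
    {f : ℝ → Euc N → ℝ → ℝ} (hf : SatH0 T M₀ f)
    {u : ℝ → Euc N → ℝ} (hu : IsSol κ f u (Set.Ici 0)) (hu0 : ∀ x, 0 ≤ u 0 x) :
    ∀ t ≥ 0, ∀ x, 0 ≤ u t x := by
  intro b hb x
  obtain ⟨R, -, hR⟩ := aux_R hκ
  obtain ⟨C, hC⟩ := hu.2.2.1 (Icc 0 b) (fun s hs => hs.1) isCompact_Icc
  obtain ⟨D, hD0, hD⟩ := aux_fbd hf C
  have := aux_mp (fun t x => - u t x) (fun t x => - RHS κ f u t x) 0 b (1 + D) C (by linarith)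
    (fun x => ((aux_cont hu x).mono (fun s hs => hs.1)).neg)
    (fun x t ht => (hu.2.2.2 x t (by rw [interior_Ici]; exact ht.1)).neg)
    (fun t ht x => (neg_le_abs _).trans (hC t ht x))
    (fun x => by simpa using hu0 x) ?_ b ⟨hb, le_rfl⟩ x
  · simpa using this
  · intro t ht x hp S hS hle
    have hm : Continuous (u t) := (hu.2.1 t ht.1.le).1.continuous
    have hJ := aux_J_le hκ hR hm.neg x S (fun y _ => hle y)
    have e : (∫ y, κ (y - x) * (-u) t y) = - ∫ y, κ (y - x) * u t y := by
      rw [← integral_neg]; congr 1; ext y; simp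
    have hJ' : - (∫ y, κ (y - x) * u t y) ≤ S := by rw [← e]; exact hJ
    have hF := hD t x (u t x) (hC t ⟨ht.1.le, ht.2.le⟩ x)
    have hx := hle x
    have h1 : -u t x * f t x (u t x) ≤ S * D := by
      have := (abs_le.1 hF).2
      calc -u t x * f t x (u t x) ≤ -u t x * D := mul_le_mul_of_nonneg_left this hp.le
        _ ≤ S * D := mul_le_mul_of_nonneg_right hx hD0.le
    simp only [RHS]
    try simp only at hp
    linarith

theorem aux_ubd {N : ℕ} {T : ℝ} (hT : 0 < T) {κ : Euc N → ℝ}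
    {f : ℝ → Euc N → ℝ → ℝ} {v : ℝ → Euc N → ℝ} (hv : PeriodicPosSol κ f T v) :
    ∃ B > 0, ∀ t x, v t x ≤ B := by
  obtain ⟨C, hC⟩ := hv.1.2.2.1 (Icc 0 T) (subset_univ _) isCompact_Icc
  refine ⟨|C| + 1, by positivity, fun t x => ?_⟩
  obtain ⟨y, hy, h⟩ := Function.Periodic.exists_mem_Ico₀
    (f := fun s => v s x) (fun s => hv.2.1 s x) hT t
  try simp only at h
  rw [h]
  have := hC y ⟨hy.1, hy.2.le⟩ x
  linarith [le_abs_self (v y x), le_abs_self C]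

theorem aux_upper {N : ℕ} {T M₀ : ℝ} (hT : 0 < T) {κ : Euc N → ℝ} (hκ : KernelHyp κ)
    {f : ℝ → Euc N → ℝ → ℝ} (hf : SatH0 T M₀ f)
    {v : ℝ → Euc N → ℝ} (hv : PeriodicPosSol κ f T v)
    {u : ℝ → Euc N → ℝ} (hu : IsSol κ f u (Set.Ici 0)) :
    ∃ A > 0, ∃ l > 0, ∀ t ≥ 0, ∀ x, u t x - v t x ≤ A * Real.exp (-l * t) := by
  obtain ⟨B, hB0, hB⟩ := aux_ubd hT hv
  obtain ⟨hvs, -, d, hd0, hd⟩ := hv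
  obtain ⟨R, -, hR⟩ := aux_R hκ
  obtain ⟨D, hD0, hD⟩ := aux_fbd hf B
  obtain ⟨η, hη0, hη⟩ := aux_mono hf (B + 1) (by linarith)
  obtain ⟨C0, hC0⟩ := (hu.2.1 0 (by simp)).2
  set A := (|C0| + 1) / d with hA
  have hA0 : 0 < A := by positivity
  set l := min η (η * d) with hl
  have hl0 : 0 < l := lt_min hη0 (by positivity)
  refine ⟨B * A, by positivity, l, hl0, ?_⟩
  intro b hb x
  obtain ⟨C, hC⟩ := hu.2.2.1 (Icc 0 b) (fun s hs => hs.1) isCompact_Icc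
  have key := aux_mp (fun t x => u t x - v t x - v t x * (A * Real.exp (-l * t)))
    (fun t x => RHS κ f u t x - RHS κ f v t x - (RHS κ f v t x * (A * Real.exp (-l * t))
      + v t x * (A * (Real.exp (-l * t) * (-l * 1))))) 0 b (1 + D) C (by linarith)
    (fun x => by
      have h1 : ContinuousOn (fun s => u s x) (Icc 0 b) := (aux_cont hu x).mono (fun s hs => hs.1)
      have h2 : ContinuousOn (fun s => v s x) (Icc 0 b) := (aux_cont hvs x).mono (subset_univ _)
      fun_prop)
    (fun x t ht => by
      have h1 := hu.2.2.2 x t (by rw [interior_Ici]; exact ht.1)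
      have h2 := hvs.2.2.2 x t (by simp)
      have h3 := ((((hasDerivAt_id t).const_mul (-l)).exp).const_mul A)
      exact (h1.sub h2).sub (h2.mul h3))
    (fun t ht x => by
      have h1 := (le_abs_self _).trans (hC t ht x)
      have h2 := hd t x
      have h3 : 0 ≤ v t x * (A * Real.exp (-l * t)) := by
        have : 0 ≤ v t x := by linarith
        positivity
      (try simp only); linarith)
    (fun x => by
      have h1 := (le_abs_self _).trans (hC0 x)
      have h2 := hd 0 x
      have h3 : d * A = |C0| + 1 := by rw [hA]; field_simp
      have h4 : d * A ≤ v 0 x * A := by gcongr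
      have := le_abs_self C0
      simp only [mul_zero, Real.exp_zero, mul_one]; linarith) ?_ b ⟨hb, le_rfl⟩ x
  · have h1 := hB b x
    have h2 : v b x * (A * Real.exp (-l * b)) ≤ B * (A * Real.exp (-l * b)) := by gcongr
    try simp only at key
    rw [mul_assoc]
    linarith
  · intro t ht x hp S hS hle
    try simp only at hp hle ⊢
    set P := A * Real.exp (-l * t) with hP
    have hP0 : 0 < P := by positivity
    have hP' : A * (Real.exp (-l * t) * (-l * 1)) = -l * P := by rw [hP]; ring
    rw [hP']
    have hmu : Continuous (u t) := (hu.2.1 t ht.1.le).1.continuous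
    have hmv : Continuous (v t) := (hvs.2.1 t (mem_univ _)).1.continuous
    have hJ := aux_J_le hκ hR (v := fun y => 1 * u t y + (-(1 + P)) * v t y) (by fun_prop) x S
      (fun y _ => by have := hle y; linarith)
    rw [aux_J_comb hκ hmu hmv] at hJ
    have hvx := hd t x
    have hvB := hB t x
    have hF := (abs_le.1 (hD t x (v t x) (by rw [abs_of_nonneg] <;> linarith))).2
    have hvP : 0 < v t x * P := mul_pos (by linarith) hP0
    have hwf : (u t x - v t x - v t x * P) * f t x (v t x) ≤ S * D :=
      (mul_le_mul_of_nonneg_left hF hp.le).trans (mul_le_mul_of_nonneg_right (hle x) hD0.le)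
    have huv : v t x ≤ u t x := by linarith
    have hre : u t x * (f t x (u t x) - f t x (v t x)) ≤ - l * (v t x * P) := by
      rcases le_total (u t x) (B + 1) with hc | hc
      · have h1 := hη t x (v t x) (u t x) (by linarith) huv hc
        have h2 : u t x * (f t x (u t x) - f t x (v t x)) ≤ u t x * (-η * (u t x - v t x)) :=
          mul_le_mul_of_nonneg_left h1 (by linarith)
        have h3 : d * (η * (v t x * P)) ≤ u t x * (η * (u t x - v t x)) := by
          apply mul_le_mul (by linarith) _ (by positivity) (by linarith)
          apply mul_le_mul_of_nonneg_left _ hη0.le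
          linarith
        have h4 : l * (v t x * P) ≤ η * d * (v t x * P) :=
          mul_le_mul_of_nonneg_right (min_le_right _ _) hvP.le
        linarith
      · have h1 := hη t x (v t x) (B + 1) (by linarith) (by linarith) le_rfl
        obtain ⟨η', hη'0, hη'⟩ := aux_mono hf (u t x) (by linarith)
        have h2 := hη' t x (B + 1) (u t x) (by linarith) hc le_rfl
        have h3 : 0 ≤ η' * (u t x - (B + 1)) := mul_nonneg hη'0.le (by linarith)
        have h4 : η * 1 ≤ η * (B + 1 - v t x) := mul_le_mul_of_nonneg_left (by linarith) hη0.le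
        have h5 : f t x (u t x) - f t x (v t x) ≤ - η := by linarith
        have h6 := mul_le_mul_of_nonneg_left h5 (show 0 ≤ u t x by linarith)
        have h7 : l * (v t x * P) ≤ η * (v t x * P) :=
          mul_le_mul_of_nonneg_right (min_le_left _ _) hvP.le
        have h8 : η * (v t x * P) ≤ η * u t x := mul_le_mul_of_nonneg_left (by linarith) hη0.le
        linarith
    simp only [RHS]
    linarith

theorem aux_mu (B R a c : ℝ) (ha : 0 < a) :
    ∃ m > 0, B * (Real.exp (m * R) - 1) ≤ a ∧ m * c ≤ a := by
  have h1 : Tendsto (fun m : ℝ => B * (Real.exp (m * R) - 1)) (nhdsWithin 0 (Ioi 0))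
      (nhds (B * (Real.exp (0 * R) - 1))) :=
    (Continuous.tendsto (by fun_prop) 0).mono_left nhdsWithin_le_nhds
  have h2 : Tendsto (fun m : ℝ => m * c) (nhdsWithin 0 (Ioi 0)) (nhds (0 * c)) :=
    (Continuous.tendsto (by fun_prop) 0).mono_left nhdsWithin_le_nhds
  obtain ⟨m, ⟨hm1, hm2⟩, hm⟩ := (((h1.eventually (gt_mem_nhds (show _ < a by simpa using ha))).and
    (h2.eventually (gt_mem_nhds (show _ < a by simpa using ha)))).and self_mem_nhdsWithin).exists
  exact ⟨m, hm, hm1.le, hm2.le⟩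

theorem aux_lower {N : ℕ} {T M₀ : ℝ} (hT : 0 < T) {κ : Euc N → ℝ} (hκ : KernelHyp κ)
    {f : ℝ → Euc N → ℝ → ℝ} (hf : SatH0 T M₀ f)
    {v : ℝ → Euc N → ℝ} (hv : PeriodicPosSol κ f T v)
    {u : ℝ → Euc N → ℝ} (hu : IsSol κ f u (Set.Ici 0)) (hu0 : ∀ x, 0 ≤ u 0 x)
    (c : ℝ) (hc : 0 < c)
    (δ τ : ℝ) (hδ : 0 < δ) (hτ : 0 < τ)
    (hpers : ∀ t ≥ τ, ∀ x : Euc N, ‖x‖ ≤ c * t → δ ≤ u t x) :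
    ∃ B > 0, ∃ l > 0, ∃ m > 0, ∀ t ≥ τ, ∀ x, v t x - u t x ≤
      B * (Real.exp (-l * (t - τ)) + Real.exp (m * (‖x‖ - c * t))) := by
  obtain ⟨B, hB0, hB⟩ := aux_ubd hT hv
  obtain ⟨hvs, -, d, hd0, hd⟩ := hv
  obtain ⟨R, hR0, hR⟩ := aux_R hκ
  obtain ⟨D, hD0, hD⟩ := aux_fbd hf B
  obtain ⟨η, hη0, hη⟩ := aux_mono hf B hB0.le
  have hun := aux_nonneg hκ hf hu hu0
  obtain ⟨m, hm0, hm1, hm2⟩ := aux_mu (B / d) R (δ * η / 2) c (by positivity)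
  refine ⟨B, hB0, δ * η, by positivity, m, hm0, ?_⟩
  intro b hb x
  set l := δ * η with hl
  have hl0 : 0 < l := by positivity
  set Φ : ℝ → Euc N → ℝ := fun t x => Real.exp (-l * (t - τ)) + Real.exp (m * (‖x‖ - c * t))
    with hΦ
  have hΦ0 : ∀ t x, 0 < Φ t x := fun t x => by simp only [hΦ]; positivity
  have key := aux_mp (fun t x => v t x - u t x - v t x * Φ t x)
    (fun t x => RHS κ f v t x - RHS κ f u t x - (RHS κ f v t x * Φ t x
      + v t x * (Real.exp (-l * (t - τ)) * (-l * 1) +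
        Real.exp (m * (‖x‖ - c * t)) * (m * -(c * 1))))) τ b (1 + D) B (by linarith)
    (fun x => by
      have h1 : ContinuousOn (fun s => u s x) (Icc τ b) :=
        (aux_cont hu x).mono (fun s hs => hτ.le.trans hs.1)
      have h2 : ContinuousOn (fun s => v s x) (Icc τ b) := (aux_cont hvs x).mono (subset_univ _)
      simp only [hΦ]
      fun_prop)
    (fun x t ht => by
      have h1 := hu.2.2.2 x t (by rw [interior_Ici]; exact hτ.trans ht.1)
      have h2 := hvs.2.2.2 x t (by simp)
      have h3 := (((hasDerivAt_id t).sub_const τ).const_mul (-l)).exp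
      have h4 := ((((hasDerivAt_id t).const_mul c).const_sub ‖x‖).const_mul m).exp
      exact (h2.sub h1).sub (h2.mul (h3.add h4)))
    (fun t ht x => by
      have h1 := hun t (hτ.le.trans ht.1) x
      have h2 := hd t x
      have h3 : 0 ≤ v t x * Φ t x := mul_nonneg (by linarith) (hΦ0 t x).le
      have := hB t x
      (try simp only); linarith)
    (fun x => by
      have h1 := hun τ hτ.le x
      have h2 := hd τ x
      have h3 : 1 ≤ Φ τ x := by
        simp only [hΦ, sub_self, mul_zero, Real.exp_zero]
        linarith [Real.exp_pos (m * (‖x‖ - c * τ))]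
      have h4 : v τ x * 1 ≤ v τ x * Φ τ x := mul_le_mul_of_nonneg_left h3 (by linarith)
      (try simp only); linarith) ?_ b ⟨hb, le_rfl⟩ x
  · have h1 := hB b x
    have h2 : v b x * Φ b x ≤ B * Φ b x := mul_le_mul_of_nonneg_right h1 (hΦ0 b x).le
    try simp only at key
    change _ ≤ B * Φ b x
    linarith
  · intro t ht x hp S hS hle
    try simp only at hp hle ⊢
    have hvx := hd t x
    have hvB := hB t x
    have hux := hun t (hτ.trans ht.1).le x
    have hcone : δ ≤ u t x := by
      apply hpers t ht.1.le
      by_contra hx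
      push Not at hx
      have h3 : 1 ≤ Φ t x := by
        have : 1 ≤ Real.exp (m * (‖x‖ - c * t)) :=
          Real.one_le_exp (mul_nonneg hm0.le (by linarith))
        simp only [hΦ]
        linarith [Real.exp_pos (-l * (t - τ))]
      have h4 : v t x * 1 ≤ v t x * Φ t x := mul_le_mul_of_nonneg_left h3 (by linarith)
      linarith
    have hmu : Continuous (u t) := (hu.2.1 t (hτ.trans ht.1).le).1.continuous
    have hmv : Continuous (v t) := (hvs.2.1 t (mem_univ _)).1.continuous
    set P := Real.exp (-l * (t - τ)) with hP
    set Q := Real.exp (m * (‖x‖ - c * t)) with hQ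
    have hP0 : 0 < P := Real.exp_pos _
    have hQ0 : 0 < Q := Real.exp_pos _
    have hPQ : Φ t x = P + Q := rfl
    have hJ := aux_J_le hκ hR (v := fun y => (1 - Φ t x) * v t y + (-1) * u t y) (by fun_prop) x
      (S + B * (Q * (Real.exp (m * R) - 1)))
      (fun y hy => by
        have h1 := hle y
        have h2 : Real.exp (m * (‖y‖ - c * t)) ≤ Q * Real.exp (m * R) := by
          rw [hQ, ← Real.exp_add]
          apply Real.exp_le_exp.2
          have : ‖y‖ ≤ ‖x‖ + R := by
            have := norm_sub_norm_le y x
            linarith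
          nlinarith
        have h3 : Φ t y - Φ t x ≤ Q * (Real.exp (m * R) - 1) := by
          rw [hPQ]; simp only [hΦ]; linarith
        have h5 : 0 ≤ Q * (Real.exp (m * R) - 1) :=
          mul_nonneg hQ0.le (by linarith [Real.one_le_exp (show 0 ≤ m * R by positivity)])
        have h4 : v t y * (Φ t y - Φ t x) ≤ B * (Q * (Real.exp (m * R) - 1)) :=
          (mul_le_mul_of_nonneg_left h3 (by linarith [hd t y])).trans
            (mul_le_mul_of_nonneg_right (hB t y) h5)
        linarith)
    rw [aux_J_comb hκ hmv hmu] at hJ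
    have hF := (abs_le.1 (hD t x (v t x) (by rw [abs_of_nonneg] <;> linarith))).2
    have hvP : 0 < v t x * Φ t x := mul_pos (by linarith) (hΦ0 t x)
    have hwf : (v t x - u t x - v t x * Φ t x) * f t x (v t x) ≤ S * D :=
      (mul_le_mul_of_nonneg_left hF hp.le).trans (mul_le_mul_of_nonneg_right (hle x) hD0.le)
    have hre : u t x * (f t x (v t x) - f t x (u t x)) ≤ - l * (v t x * Φ t x) := by
      have h1 := hη t x (u t x) (v t x) hux (by linarith) hvB
      have h2 := mul_le_mul_of_nonneg_left h1 hux
      have h3 : δ * (η * (v t x * Φ t x)) ≤ u t x * (η * (v t x - u t x)) := by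
        apply mul_le_mul hcone _ (by positivity) hux
        apply mul_le_mul_of_nonneg_left _ hη0.le
        linarith
      rw [hl]
      linarith
    have hE : B * (Q * (Real.exp (m * R) - 1)) ≤ v t x * (Q * (l / 2)) := by
      have h1 : B * (Real.exp (m * R) - 1) ≤ d * (l / 2) := by
        have := mul_le_mul_of_nonneg_left hm1 hd0.le
        calc B * (Real.exp (m * R) - 1) = d * (B / d * (Real.exp (m * R) - 1)) := by field_simp
          _ ≤ _ := this
      have h2 := mul_le_mul_of_nonneg_left h1 hQ0.le
      have h3 : d * (Q * (l / 2)) ≤ v t x * (Q * (l / 2)) :=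
        mul_le_mul_of_nonneg_right hvx (by positivity)
      linarith
    have hG : v t x * (Q * (m * c)) ≤ v t x * (Q * (l / 2)) := by
      apply mul_le_mul_of_nonneg_left _ (by linarith)
      exact mul_le_mul_of_nonneg_left hm2 hQ0.le
    rw [hPQ] at *
    simp only [RHS]
    linarith

/-- persistence at sublinear spreading speed implies locally uniform
convergence to the periodic solution (radial version). -/
theorem stmt16 {N : ℕ} (hN : 1 ≤ N) (T M₀ : ℝ) (hT : 0 < T) (hM₀ : 0 < M₀)
    (κ : Euc N → ℝ) (hκ : KernelHyp κ)
    (f : ℝ → Euc N → ℝ → ℝ) (hf : SatH0 T M₀ f)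
    (f₀ : ℝ → Euc N → ℝ → ℝ) (p : Fin N → ℝ) (h1 : SatH1 T M₀ p f f₀)
    (ustar : ℝ → Euc N → ℝ) (hstar : PeriodicPosSol κ f T ustar)
    (u₀star : ℝ → Euc N → ℝ) (h0star : PeriodicMediaSol κ f₀ T p u₀star)
    (c : ℝ) (hc : 0 < c)
    (u : ℝ → Euc N → ℝ) (hu : IsSol κ f u (Set.Ici 0)) (hu0 : ∀ x, 0 ≤ u 0 x)
    (δ Tstar : ℝ) (hδ : 0 < δ) (hTstar : 0 < Tstar)
    (hpers : ∀ t ≥ Tstar, ∀ x : Euc N, ‖x‖ ≤ c * t → δ ≤ u t x) :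
    ∀ c' : ℝ, 0 < c' → c' < c → ∀ ε > (0:ℝ), ∃ t₀ : ℝ, ∀ t ≥ t₀, ∀ x : Euc N,
      ‖x‖ ≤ c' * t → |u t x - ustar t x| ≤ ε := by
  intro c' hc' hcc ε hε
  obtain ⟨A, hA, l1, hl1, hU⟩ := aux_upper hT hκ hf hstar hu
  obtain ⟨B, hB, l2, hl2, m, hm, hL⟩ :=
    aux_lower hT hκ hf hstar hu hu0 c hc δ Tstar hδ hTstar hpers
  have tl : ∀ k : ℝ, 0 < k → Tendsto (fun t : ℝ => Real.exp (-(k * t))) atTop (nhds 0) := by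
    intro k hk
    exact Real.tendsto_exp_neg_atTop_nhds_zero.comp (tendsto_id.const_mul_atTop hk)
  have e1 : ∀ᶠ t in atTop, A * Real.exp (-(l1 * t)) < ε := by
    have := (tl l1 hl1).const_mul A
    rw [mul_zero] at this
    exact this.eventually (gt_mem_nhds hε)
  have e2 : ∀ᶠ t in atTop, B * (Real.exp (l2 * Tstar) * Real.exp (-(l2 * t)) +
      Real.exp (-(m * (c - c') * t))) < ε := by
    have := (((tl l2 hl2).const_mul (Real.exp (l2 * Tstar))).add
      (tl (m * (c - c')) (mul_pos hm (by linarith)))).const_mul B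
    rw [mul_zero, add_zero, mul_zero] at this
    exact this.eventually (gt_mem_nhds hε)
  obtain ⟨t₀, ht₀⟩ := eventually_atTop.1 ((e1.and e2).and (eventually_ge_atTop Tstar))
  refine ⟨t₀, fun t ht x hx => ?_⟩
  obtain ⟨⟨h1, h2⟩, h3⟩ := ht₀ t ht
  have hu1 := hU t (by linarith) x
  have hl1 := hL t h3 x
  rw [neg_mul] at hu1
  have h4 : Real.exp (m * (‖x‖ - c * t)) ≤ Real.exp (-(m * (c - c') * t)) := by
    apply Real.exp_le_exp.2
    nlinarith
  have h5 : Real.exp (-l2 * (t - Tstar)) = Real.exp (l2 * Tstar) * Real.exp (-(l2 * t)) := by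
    rw [← Real.exp_add]; congr 1; ring
  rw [h5] at hl1
  have h6 : B * (Real.exp (l2 * Tstar) * Real.exp (-(l2 * t)) + Real.exp (m * (‖x‖ - c * t))) ≤
      B * (Real.exp (l2 * Tstar) * Real.exp (-(l2 * t)) + Real.exp (-(m * (c - c') * t))) := by
    gcongr
  rw [abs_le]
  constructor <;> linarith

end
end
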